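/- arXiv:1902.00946 — 3 statements merged into one kernel-verified Lean document; each statement's English description precedes it below -/
import Mathlib

section
/- Consider a transportation network with flow-density functions satisfying the standing assumptions, an origin o and a destination d ≠ o reachable from o. For every throughput λ with 0 ≤ λ < C^mincut, the set {y ∈ ℝ₊^E : By = λ(δ^(o) − δ^(d))} of o-d equilibrium flows of throughput λ intersects the set F of feasible flows, and the total latency L admits a unique minimizer y*(λ) over {y ∈ ℝ₊^E : By = λ(δ^(o) − δ^(d))} ∩ F; moreover L(y) < L(y') for this minimizer y = y*(λ) and every other equilibrium flow y' of throughput λ (with L(y') := +∞ when y' ∉ F). -/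
open Set Filter Topology

noncomputable section

namespace Traffic

/-- The standing assumptions on a flow-density function `φ`: twice continuously
differentiable, strictly increasing and strictly concave on `[0,∞)`, with `φ 0 = 0`
(finiteness of `φ'(0)` is automatic for real-valued `φ`). -/
def Standing (φ : ℝ → ℝ) : Prop :=
  ContDiffOn ℝ 2 φ (Set.Ici 0) ∧ StrictMonoOn φ (Set.Ici 0) ∧
    StrictConcaveOn ℝ (Set.Ici 0) φ ∧ φ 0 = 0

/-- The capacity `C = sup {φ x : x ≥ 0}`, as an extended nonnegative real. -/
def cap (φ : ℝ → ℝ) : ENNReal := ⨆ x ∈ Set.Ici (0:ℝ), ENNReal.ofReal (φ x)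

/-- The inverse of `φ` on `[0,∞)`. -/
def phiInv (φ : ℝ → ℝ) (y : ℝ) : ℝ := Function.invFunOn φ (Set.Ici 0) y

/-- The latency function `τ` associated to a flow-density function `φ`:
`τ 0 = 1/φ'(0)` and `τ y = φ⁻¹(y)/y` for `y ≠ 0`. -/
def latency (φ : ℝ → ℝ) (y : ℝ) : ℝ :=
  if y = 0 then 1 / derivWithin φ (Set.Ici 0) 0 else phiInv φ y / y

/-- The domain `[0, C)` of the latency function. -/
def latDom (φ : ℝ → ℝ) : Set ℝ := {y | 0 ≤ y ∧ ENNReal.ofReal y < cap φ}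

variable {V E : Type*}

/-- Node-link incidence matrix. -/
def Bmat [DecidableEq V] (θ κ : E → V) (v : V) (i : E) : ℝ :=
  if v = θ i then 1 else if v = κ i then -1 else 0

/-- `p` is a simple path from `o` to `d`: nonempty list of links, starting at `o`,
ending at `d`, consecutive, and visiting no node twice. -/
def IsSimplePath (θ κ : E → V) (o d : V) (p : List E) : Prop :=
  p ≠ [] ∧ (p.map θ).head? = some o ∧ (p.map κ).getLast? = some d ∧
    List.Chain' (fun a b => κ a = θ b) p ∧ (o :: p.map κ).Nodup

/-- The type of simple paths from `o` to `d`. -/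
abbrev Path (θ κ : E → V) (o d : V) := {p : List E // IsSimplePath θ κ o d p}

/-- Link-path incidence matrix. -/
def Amat [DecidableEq E] (θ κ : E → V) (o d : V) (i : E) (γ : Path θ κ o d) : ℝ :=
  if i ∈ γ.1 then 1 else 0

/-- The flow `y^z = A z` associated to a path preference vector `z`. -/
def flowOf [Fintype E] [DecidableEq E] (θ κ : E → V) (o d : V) [Fintype (Path θ κ o d)]
    (z : Path θ κ o d → ℝ) (i : E) : ℝ :=
  ∑ γ, Amat θ κ o d i γ * z γ

/-- The simplex `S_λ` of path preference vectors of total mass `lam`. -/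
def pathSimplex (lam : ℝ) (Γ : Type*) [Fintype Γ] : Set (Γ → ℝ) :=
  {z | (∀ γ, 0 ≤ z γ) ∧ ∑ γ, z γ = lam}

/-- The set `F` of feasible flows. -/
def feas [Fintype E] (φ : E → ℝ → ℝ) : Set (E → ℝ) :=
  {y | ∀ i, 0 ≤ y i ∧ ENNReal.ofReal (y i) < cap (φ i)}

/-- The set of `o`-`d` equilibrium flow vectors of throughput `lam`. -/
def eqFlow [Fintype E] [DecidableEq V] (θ κ : E → V) (o d : V) (lam : ℝ) :
    Set (E → ℝ) :=
  {y | (∀ i, 0 ≤ y i) ∧ ∀ v, (∑ i, Bmat θ κ v i * y i) =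
      lam * ((if v = o then (1:ℝ) else 0) - (if v = d then 1 else 0))}

/-- The min-cut capacity between `o` and `d`. -/
def minCut [Fintype V] [Fintype E] [DecidableEq V] (θ κ : E → V) (o d : V)
    (φ : E → ℝ → ℝ) : ENNReal :=
  ⨅ U ∈ {U : Finset V | o ∈ U ∧ d ∉ U},
    ∑ i ∈ Finset.univ.filter (fun i => θ i ∈ U ∧ κ i ∉ U), cap (φ i)

/-- The total latency `L(y) = ∑ i, y i * τ_i (y i)`. -/
def totLat [Fintype E] (φ : E → ℝ → ℝ) (y : E → ℝ) : ℝ :=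
  ∑ i, y i * latency (φ i) (y i)

/-- A decentralized monotone feedback pricing policy: on each link, a nondecreasing
nonnegative function of the flow on that link only. -/
def MonotonePolicy [Fintype E] (φ ω : E → ℝ → ℝ) : Prop :=
  ∀ i, MonotoneOn (ω i) (latDom (φ i)) ∧ ∀ y ∈ latDom (φ i), 0 ≤ ω i y

/-- A Lipschitz (decentralized) pricing policy. -/
def LipschitzPolicy [Fintype E] (φ ω : E → ℝ → ℝ) : Prop :=
  ∀ i, ∃ K : NNReal, LipschitzOnWith K (ω i) (latDom (φ i))

/-- Perceived cost (total latency plus total toll) of path `γ` at flow `y`. -/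
def pathCost [Fintype E] [DecidableEq E] (θ κ : E → V) (o d : V)
    [Fintype (Path θ κ o d)] (φ ω : E → ℝ → ℝ) (y : E → ℝ) (γ : Path θ κ o d) : ℝ :=
  ∑ i, Amat θ κ o d i γ * (latency (φ i) (y i) + ω i (y i))

/-- Generalized Wardrop equilibrium with feedback pricing. -/
def IsGWE [Fintype E] [DecidableEq V] [DecidableEq E] (θ κ : E → V) (o d : V)
    [Fintype (Path θ κ o d)] (φ ω : E → ℝ → ℝ) (lam : ℝ) (y : E → ℝ) : Prop :=
  y ∈ feas φ ∧ y ∈ eqFlow θ κ o d lam ∧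
    ∃ z ∈ pathSimplex lam (Path θ κ o d), (∀ i, y i = flowOf θ κ o d z i) ∧
      ∀ γ, 0 < z γ → ∀ γ', pathCost θ κ o d φ ω y γ ≤ pathCost θ κ o d φ ω y γ'

/-- The local routing split `G_j(z)`. -/
def Gsplit [Fintype E] [DecidableEq V] [DecidableEq E] (θ κ : E → V) (o d : V)
    [Fintype (Path θ κ o d)] (z : Path θ κ o d → ℝ) (j : E) : ℝ :=
  if 0 < ∑ i ∈ Finset.univ.filter (fun i => θ i = θ j), flowOf θ κ o d z i then
    flowOf θ κ o d z j / ∑ i ∈ Finset.univ.filter (fun i => θ i = θ j), flowOf θ κ o d z i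
  else 1 / (Finset.univ.filter (fun i => θ i = θ j)).card

/-- The drift `H_i(y, z)` of the fast-scale traffic dynamics. -/
def drift [Fintype E] [DecidableEq V] [DecidableEq E] (θ κ : E → V) (o d : V)
    [Fintype (Path θ κ o d)] (lam : ℝ) (z : Path θ κ o d → ℝ) (y : E → ℝ) (i : E) : ℝ :=
  Gsplit θ κ o d z i * (lam * (if θ i = o then 1 else 0)
      + ∑ j ∈ Finset.univ.filter (fun j => κ j = θ i), y j) - y i

/-- The set `Z` of feasible path preferences. -/
def Zfeas [Fintype E] [DecidableEq E] (θ κ : E → V) (o d : V)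
    [Fintype (Path θ κ o d)] (φ : E → ℝ → ℝ) (lam : ℝ) : Set (Path θ κ o d → ℝ) :=
  {z ∈ pathSimplex lam (Path θ κ o d) | (fun i => flowOf θ κ o d z i) ∈ feas φ}

/-- The relative interior `Z°` of `Z`. -/
def Zint [Fintype E] [DecidableEq E] (θ κ : E → V) (o d : V)
    [Fintype (Path θ κ o d)] (φ : E → ℝ → ℝ) (lam : ℝ) : Set (Path θ κ o d → ℝ) :=
  {z ∈ Zfeas θ κ o d φ lam | ∀ γ, 0 < z γ}

/-- Euclidean norm of a vector indexed by a finite type. -/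
def euclNorm {α : Type*} [Fintype α] (v : α → ℝ) : ℝ := Real.sqrt (∑ a, v a ^ 2)

/-- The `γ` component of the projected gradient `Φ ∇h(z)` of `h` (derivative taken
within `Zh`), where `Φ = I - |Γ|⁻¹ 𝟙𝟙'`. -/
def projGrad {Γ : Type*} [Fintype Γ] [DecidableEq Γ] (h : (Γ → ℝ) → ℝ)
    (Zh : Set (Γ → ℝ)) (z : Γ → ℝ) (γ : Γ) : ℝ :=
  fderivWithin ℝ h Zh z (fun γ' => (if γ' = γ then (1:ℝ) else 0) - 1 / (Fintype.card Γ : ℝ))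

/-- `h` is an admissible perturbation with domain `Zh ⊆ Zset`: closed convex domain,
strictly convex, twice continuously differentiable on the (intrinsic) interior of its
domain, with projected gradient blowing up at the (intrinsic) boundary. -/
def Admissible {Γ : Type*} [Fintype Γ] [DecidableEq Γ] (Zset Zh : Set (Γ → ℝ))
    (h : (Γ → ℝ) → ℝ) : Prop :=
  Zh ⊆ Zset ∧ IsClosed Zh ∧ Convex ℝ Zh ∧ StrictConvexOn ℝ Zh h ∧
    ContDiffOn ℝ 2 h (intrinsicInterior ℝ Zh) ∧
    ∀ z₀ ∈ intrinsicFrontier ℝ Zh,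
      Tendsto (fun z => euclNorm (projGrad h Zh z))
        (nhdsWithin z₀ (intrinsicInterior ℝ Zh)) atTop

/-- `Fh` is the perturbed best response associated to the admissible perturbation `h`
with domain `Zh`: for all latencies `l` and tolls `w`, `Fh l w` is the unique minimizer
over `Zh` of `α ↦ α' A' (l + w) + h α`. -/
def IsPerturbedBR [Fintype E] [DecidableEq E] (θ κ : E → V) (o d : V)
    [Fintype (Path θ κ o d)] (Zh : Set (Path θ κ o d → ℝ)) (h : (Path θ κ o d → ℝ) → ℝ)
    (Fh : (E → ℝ) → (E → ℝ) → (Path θ κ o d → ℝ)) : Prop :=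
  ∀ l w : E → ℝ, Fh l w ∈ Zh ∧ ∀ α ∈ Zh, α ≠ Fh l w →
    (∑ γ, Fh l w γ * (∑ i, Amat θ κ o d i γ * (l i + w i)) + h (Fh l w)) <
      (∑ γ, α γ * (∑ i, Amat θ κ o d i γ * (l i + w i)) + h α)

/-- A solution of the closed-loop multiscale dynamics with update rate `η`:
locally Lipschitz trajectories `x(t)` (densities) and `z(t)` (path preferences)
with `z(t) ∈ S_λ`, `x(t) ≥ 0`, satisfying `ẋ = H(φ(x), z)` and
`ż = η (Fh(l, w) - z)` for `l_i = τ_i(y_i)`, `w_i = ω_i(y_i)`, `y = φ(x)`. -/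
def IsSolution [Fintype E] [DecidableEq V] [DecidableEq E] (θ κ : E → V) (o d : V)
    [Fintype (Path θ κ o d)] (φ ω : E → ℝ → ℝ) (lam η : ℝ)
    (Fh : (E → ℝ) → (E → ℝ) → (Path θ κ o d → ℝ))
    (x : ℝ → E → ℝ) (z : ℝ → Path θ κ o d → ℝ) : Prop :=
  LocallyLipschitz x ∧ LocallyLipschitz z ∧
    (∀ t ≥ (0:ℝ), z t ∈ pathSimplex lam (Path θ κ o d)) ∧
    (∀ t ≥ (0:ℝ), ∀ i, 0 ≤ x t i) ∧
    (∀ t ≥ (0:ℝ), ∀ i, HasDerivWithinAt (fun s => x s i)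
        (drift θ κ o d lam (z t) (fun j => φ j (x t j)) i) (Set.Ici 0) t) ∧
    (∀ t ≥ (0:ℝ), ∀ γ, HasDerivWithinAt (fun s => z s γ)
        (η * (Fh (fun i => latency (φ i) (φ i (x t i)))
            (fun i => ω i (φ i (x t i))) γ - z t γ)) (Set.Ici 0) t)

/-- The potential `Θ(z) = ∑ i ∫_0^{(Az)_i} (τ_i + ω_i)`. -/
def Theta [Fintype E] [DecidableEq E] (θ κ : E → V) (o d : V)
    [Fintype (Path θ κ o d)] (φ ω : E → ℝ → ℝ) (z : Path θ κ o d → ℝ) : ℝ :=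
  ∑ i, ∫ s in (0:ℝ)..(flowOf θ κ o d z i), (latency (φ i) s + ω i s)

/-- The entropic objective `Θ(z) + β⁻¹ ∑ γ z_γ log z_γ`. -/
def entObj [Fintype E] [DecidableEq E] (θ κ : E → V) (o d : V)
    [Fintype (Path θ κ o d)] (φ ω : E → ℝ → ℝ) (β : ℝ) (z : Path θ κ o d → ℝ) : ℝ :=
  Theta θ κ o d φ ω z + β⁻¹ * ∑ γ, z γ * Real.log (z γ)


lemma Standing.continuousOn {φ : ℝ → ℝ} (h : Standing φ) : ContinuousOn φ (Set.Ici 0) :=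
  h.1.continuousOn

lemma Standing.nonneg {φ : ℝ → ℝ} (h : Standing φ) {x : ℝ} (hx : 0 ≤ x) : 0 ≤ φ x := by
  have := h.2.1.monotoneOn Set.self_mem_Ici hx hx
  rwa [h.2.2.2] at this

lemma Standing.exists_eq_of_le {φ : ℝ → ℝ} (h : Standing φ) {x y : ℝ} (hx : 0 ≤ x)
    (hy : 0 ≤ y) (hyx : y ≤ φ x) : ∃ z ∈ Set.Icc 0 x, φ z = y :=
  intermediate_value_Icc hx (h.continuousOn.mono Set.Icc_subset_Ici_self)
    ⟨h.2.2.2.le.trans hy, hyx⟩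

lemma Standing.ofReal_lt_cap {φ : ℝ → ℝ} (h : Standing φ) {x : ℝ} (hx : 0 ≤ x) :
    ENNReal.ofReal (φ x) < cap φ := by
  have hx1 : (0 : ℝ) ≤ x + 1 := by linarith
  have hlt : φ x < φ (x + 1) := h.2.1 hx hx1 (by linarith)
  exact ((ENNReal.ofReal_lt_ofReal_iff_of_nonneg (h.nonneg hx)).2 hlt).trans_le
    (le_iSup₂_of_le (x + 1) hx1 le_rfl)

lemma Standing.exists_eq_of_lt_cap {φ : ℝ → ℝ} (h : Standing φ) {y : ℝ} (hy : 0 ≤ y)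
    (hyc : ENNReal.ofReal y < cap φ) : ∃ x, 0 ≤ x ∧ φ x = y := by
  obtain ⟨x, hx, hlt⟩ : ∃ x ∈ Set.Ici (0 : ℝ), ENNReal.ofReal y < ENNReal.ofReal (φ x) := by
    simpa only [cap, lt_iSup_iff, exists_prop] using hyc
  obtain ⟨z, hz, rfl⟩ := h.exists_eq_of_le hx hy
    ((ENNReal.ofReal_lt_ofReal_iff_of_nonneg hy).1 hlt).le
  exact ⟨z, hz.1, rfl⟩

lemma Standing.mul_latency {φ : ℝ → ℝ} (h : Standing φ) {x : ℝ} (hx : 0 ≤ x) :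
    φ x * latency φ (φ x) = x := by
  by_cases h0 : φ x = 0
  · have : x = 0 := h.2.1.injOn hx Set.self_mem_Ici (h0.trans h.2.2.2.symm)
    rw [h0, zero_mul, this]
  · rw [latency, if_neg h0, mul_div_cancel₀ _ h0, phiInv]
    exact h.2.1.injOn.leftInvOn_invFunOn hx

lemma Standing.tendsto_cap {φ : ℝ → ℝ} (h : Standing φ) :
    Tendsto (fun x => ENNReal.ofReal (φ x)) atTop (𝓝 (cap φ)) := by
  refine tendsto_order.2 ⟨fun a ha => ?_, fun b hb => ?_⟩
  · obtain ⟨x, hx, hlt⟩ : ∃ x ∈ Set.Ici (0 : ℝ), a < ENNReal.ofReal (φ x) := by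
      simpa only [cap, lt_iSup_iff, exists_prop] using ha
    filter_upwards [eventually_ge_atTop x] with z hz
    exact hlt.trans_le (ENNReal.ofReal_le_ofReal
      (h.2.1.monotoneOn hx (le_trans (Set.mem_Ici.1 hx) hz) hz))
  · filter_upwards [eventually_ge_atTop 0] with z hz
    exact (h.ofReal_lt_cap hz).trans hb

lemma Bmat_eq_sub [DecidableEq V] {θ κ : E → V} {i : E} (hloop : θ i ≠ κ i) (v : V) :
    Bmat θ κ v i = (if v = θ i then 1 else 0) - (if v = κ i then 1 else 0) := by
  unfold Bmat
  split_ifs <;> simp_all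

/-- A flow direction of unit value from `o` to `w` that can be followed from `y` without leaving
the box `0 ≤ y ≤ c` to first order. -/
def IsAugmenting [Fintype E] [DecidableEq V] (θ κ : E → V) (c y : E → ℝ) (o w : V)
    (g : E → ℝ) : Prop :=
  (∀ i, y i = 0 → 0 ≤ g i) ∧ (∀ i, y i = c i → g i ≤ 0) ∧
    ∀ u, ∑ i, Bmat θ κ u i * g i = (if u = o then 1 else 0) - (if u = w then 1 else 0)

lemma IsAugmenting.extend_forward [Fintype E] [DecidableEq V] {θ κ : E → V} {c y g : E → ℝ}
    {o : V} {i : E} (hloop : θ i ≠ κ i) (hg : IsAugmenting θ κ c y o (θ i) g)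
    (hi : y i ≠ c i) : ∃ g', IsAugmenting θ κ c y o (κ i) g' := by
  classical
  refine ⟨g + Pi.single i 1, fun j hj => ?_, fun j hj => ?_, fun u => ?_⟩
  · have := hg.1 j hj
    by_cases hji : j = i
    · subst hji; simp; linarith
    · simpa [hji] using this
  · have hji : j ≠ i := by rintro rfl; exact hi hj
    simpa [hji] using hg.2.1 j hj
  · simp only [Pi.add_apply, mul_add, Finset.sum_add_distrib, hg.2.2 u, Pi.single_apply,
      mul_ite, mul_one, mul_zero, Finset.sum_ite_eq', Finset.mem_univ, if_true,
      Bmat_eq_sub hloop]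
    ring

lemma IsAugmenting.extend_backward [Fintype E] [DecidableEq V] {θ κ : E → V} {c y g : E → ℝ}
    {o : V} {i : E} (hloop : θ i ≠ κ i) (hg : IsAugmenting θ κ c y o (κ i) g)
    (hi : y i ≠ 0) : ∃ g', IsAugmenting θ κ c y o (θ i) g' := by
  classical
  refine ⟨g - Pi.single i 1, fun j hj => ?_, fun j hj => ?_, fun u => ?_⟩
  · have hji : j ≠ i := by rintro rfl; exact hi hj
    simpa [hji] using hg.1 j hj
  · have := hg.2.1 j hj
    by_cases hji : j = i
    · subst hji; simp; linarith
    · simpa [hji] using this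
  · simp only [Pi.sub_apply, mul_sub, Finset.sum_sub_distrib, hg.2.2 u, Pi.single_apply,
      mul_ite, mul_one, mul_zero, Finset.sum_ite_eq', Finset.mem_univ, if_true,
      Bmat_eq_sub hloop]
    ring

lemma IsAugmenting.exists_step [Fintype E] [DecidableEq V] {θ κ : E → V} {c y g : E → ℝ}
    {o w : V} (hg : IsAugmenting θ κ c y o w g) (h0 : ∀ i, 0 ≤ y i) (hc : ∀ i, y i ≤ c i)
    {r : ℝ} (hr : 0 < r) :
    ∃ ε, 0 < ε ∧ ε ≤ r ∧ ∀ i, 0 ≤ y i + ε * g i ∧ y i + ε * g i ≤ c i := by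
  have key : ∀ i, ∀ᶠ ε in 𝓝[>] (0 : ℝ), 0 ≤ y i + ε * g i ∧ y i + ε * g i ≤ c i := by
    intro i
    have ht : Tendsto (fun ε : ℝ => y i + ε * g i) (𝓝[>] 0) (𝓝 (y i)) := by
      have : Continuous (fun ε : ℝ => y i + ε * g i) := by fun_prop
      simpa using (this.tendsto 0).mono_left nhdsWithin_le_nhds
    refine Eventually.and ?_ ?_
    · rcases (h0 i).eq_or_lt with h | h
      · filter_upwards [self_mem_nhdsWithin] with ε hε
        rw [← h, zero_add]
        exact mul_nonneg (Set.mem_Ioi.1 hε).le (hg.1 i h.symm)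
      · exact (ht.eventually_const_lt h).mono fun _ => le_of_lt
    · rcases (hc i).eq_or_lt with h | h
      · filter_upwards [self_mem_nhdsWithin] with ε hε
        have := mul_nonpos_of_nonneg_of_nonpos (Set.mem_Ioi.1 hε).le (hg.2.1 i h)
        linarith
      · exact (ht.eventually_lt_const h).mono fun _ => le_of_lt
  obtain ⟨ε, h1, h2, h3⟩ := ((eventually_all.2 key).and
    (Ioc_mem_nhdsGT hr : ∀ᶠ ε in 𝓝[>] (0 : ℝ), ε ∈ Set.Ioc 0 r)).exists
  exact ⟨ε, h2, h3, h1⟩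

/-- The nontrivial half of the max-flow min-cut theorem, for real capacities. -/
theorem exists_eqFlow_le [Fintype V] [Fintype E] [DecidableEq V] {θ κ : E → V}
    (hloop : ∀ i, θ i ≠ κ i) {o d : V} {c : E → ℝ} (hc : ∀ i, 0 ≤ c i)
    {lam : ℝ} (hlam : 0 ≤ lam)
    (hcut : ∀ U : Finset V, o ∈ U → d ∉ U →
      lam ≤ ∑ i ∈ Finset.univ.filter (fun i => θ i ∈ U ∧ κ i ∉ U), c i) :
    ∃ y ∈ eqFlow θ κ o d lam, ∀ i, y i ≤ c i := by
  classical
  let S : Set ((E → ℝ) × ℝ) := (Set.Icc 0 c ×ˢ Set.Icc 0 lam) ∩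
    {p | ∀ w, (∑ i, Bmat θ κ w i * p.1 i) =
      p.2 * ((if w = o then (1 : ℝ) else 0) - (if w = d then 1 else 0))}
  have hS : IsCompact S := by
    refine (isCompact_Icc.prod isCompact_Icc).inter_right ?_
    simp only [Set.ofPred_forall]
    exact isClosed_iInter fun w => isClosed_eq (by fun_prop) (by fun_prop)
  have hne : S.Nonempty := ⟨0, ⟨⟨le_rfl, hc⟩, ⟨le_rfl, hlam⟩⟩, by simp⟩
  obtain ⟨⟨y, v⟩, ⟨⟨⟨hy0, hyc⟩, hv0, hvl⟩, hyv⟩, hmax⟩ :=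
    hS.exists_isMaxOn hne continuous_snd.continuousOn
  simp only [Set.mem_ofPred_eq] at hy0 hyc hv0 hvl hyv
  rcases hvl.eq_or_lt with rfl | hlt
  · exact ⟨y, ⟨hy0, hyv⟩, hyc⟩
  exfalso
  by_cases hd : ∃ g, IsAugmenting θ κ c y o d g
  · obtain ⟨g, hg⟩ := hd
    obtain ⟨ε, hε, hεr, hbox⟩ := hg.exists_step hy0 hyc (sub_pos.2 hlt)
    have hmem : (y + ε • g, v + ε) ∈ S := by
      refine ⟨⟨⟨fun i => (hbox i).1, fun i => (hbox i).2⟩,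
        ⟨by simp only; linarith, by simp only; linarith⟩⟩, fun w => ?_⟩
      simp only [Pi.add_apply, Pi.smul_apply, smul_eq_mul, mul_add, Finset.sum_add_distrib,
        hyv w, mul_left_comm _ ε, ← Finset.mul_sum, hg.2.2 w]
      ring
    have := hmax hmem
    simp only [Set.mem_ofPred_eq] at this
    linarith
  · let U : Finset V := Finset.univ.filter fun w => ∃ g, IsAugmenting θ κ c y o w g
    have hU : ∀ w, w ∈ U ↔ ∃ g, IsAugmenting θ κ c y o w g := fun w => by simp [U]
    have hoU : o ∈ U := (hU o).2 ⟨0, by simp, by simp, by simp⟩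
    have hdU : d ∉ U := fun h => hd ((hU d).1 h)
    have hval : ∑ w ∈ U, ∑ i, Bmat θ κ w i * y i = v := by
      simp only [hyv, ← Finset.mul_sum, Finset.sum_sub_distrib, Finset.sum_ite_eq', hoU, hdU,
        if_true, if_false, sub_zero, mul_one]
    have hnet : ∑ w ∈ U, ∑ i, Bmat θ κ w i * y i =
        ∑ i, ((if θ i ∈ U then 1 else 0) - (if κ i ∈ U then 1 else 0)) * y i := by
      rw [Finset.sum_comm]
      refine Finset.sum_congr rfl fun i _ => ?_
      simp only [← Finset.sum_mul, Bmat_eq_sub (hloop i), Finset.sum_sub_distrib,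
        Finset.sum_ite_eq']
    have hle : ∑ i ∈ Finset.univ.filter (fun i => θ i ∈ U ∧ κ i ∉ U), c i ≤
        ∑ i, ((if θ i ∈ U then 1 else 0) - (if κ i ∈ U then 1 else 0)) * y i := by
      rw [Finset.sum_filter]
      refine Finset.sum_le_sum fun i _ => ?_
      by_cases h1 : θ i ∈ U <;> by_cases h2 : κ i ∈ U
      · simp [h1, h2]
      · have : y i = c i := by
          by_contra hne
          obtain ⟨g, hg⟩ := (hU _).1 h1
          exact h2 ((hU _).2 (hg.extend_forward (hloop i) hne))
        simp [h1, h2, this]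
      · have : y i = 0 := by
          by_contra hne
          obtain ⟨g, hg⟩ := (hU _).1 h2
          exact h1 ((hU _).2 (hg.extend_backward (hloop i) hne))
        simp [h1, h2, this]
      · simp [h1, h2]
    have := hcut U hoU hdU
    linarith

lemma exists_density_cut_le [Fintype V] [Fintype E] [DecidableEq V] {θ κ : E → V}
    {φ : E → ℝ → ℝ} (hφ : ∀ i, Standing (φ i)) {o d : V} {lam : ℝ}
    (hlam : ENNReal.ofReal lam < minCut θ κ o d φ) :
    ∃ x, 0 ≤ x ∧ ∀ U : Finset V, o ∈ U → d ∉ U →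
      lam ≤ ∑ i ∈ Finset.univ.filter (fun i => θ i ∈ U ∧ κ i ∉ U), φ i x := by
  have key : ∀ U : Finset V, ∀ᶠ x in atTop, o ∈ U → d ∉ U →
      ENNReal.ofReal lam <
        ∑ i ∈ Finset.univ.filter (fun i => θ i ∈ U ∧ κ i ∉ U), ENNReal.ofReal (φ i x) := by
    intro U
    by_cases hU : o ∈ U ∧ d ∉ U
    · have hlt : ENNReal.ofReal lam <
          ∑ i ∈ Finset.univ.filter (fun i => θ i ∈ U ∧ κ i ∉ U), cap (φ i) :=
        hlam.trans_le (iInf₂_le U hU)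
      filter_upwards [(tendsto_finsetSum _ fun i _ =>
        (hφ i).tendsto_cap).eventually_const_lt hlt] with x hx _ _ using hx
    · exact Eventually.of_forall fun x h1 h2 => (hU ⟨h1, h2⟩).elim
  obtain ⟨x, hx, hx0⟩ := ((eventually_all.2 key).and (eventually_ge_atTop 0)).exists
  refine ⟨x, hx0, fun U hoU hdU => ?_⟩
  have := hx U hoU hdU
  rw [← ENNReal.ofReal_sum_of_nonneg fun i _ => (hφ i).nonneg hx0] at this
  exact (ENNReal.ofReal_lt_ofReal_iff'.1 this).1.le

lemma mem_feas_of_density [Fintype E] {φ : E → ℝ → ℝ} (hφ : ∀ i, Standing (φ i)) {x : E → ℝ}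
    (hx : 0 ≤ x) : (fun i => φ i (x i)) ∈ feas φ :=
  fun i => ⟨(hφ i).nonneg (hx i), (hφ i).ofReal_lt_cap (hx i)⟩

lemma exists_density_of_mem_feas [Fintype E] {φ : E → ℝ → ℝ} (hφ : ∀ i, Standing (φ i))
    {y : E → ℝ} (hy : y ∈ feas φ) : ∃ x : E → ℝ, 0 ≤ x ∧ y = fun i => φ i (x i) := by
  choose x hx hxy using fun i => (hφ i).exists_eq_of_lt_cap (hy i).1 (hy i).2
  exact ⟨x, hx, funext fun i => (hxy i).symm⟩

lemma totLat_density [Fintype E] {φ : E → ℝ → ℝ} (hφ : ∀ i, Standing (φ i)) {x : E → ℝ}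
    (hx : 0 ≤ x) : totLat φ (fun i => φ i (x i)) = ∑ i, x i :=
  Finset.sum_congr rfl fun i _ => (hφ i).mul_latency (hx i)

lemma Standing.exists_midpoint {φ : ℝ → ℝ} (h : Standing φ) {a b : ℝ} (ha : 0 ≤ a)
    (hb : 0 ≤ b) :
    ∃ z, 0 ≤ z ∧ φ z = (φ a + φ b) / 2 ∧ z ≤ (a + b) / 2 ∧ (a ≠ b → z < (a + b) / 2) := by
  have hab : 0 ≤ (a + b) / 2 := by positivity
  by_cases hne : a = b
  · subst hne
    exact ⟨a, ha, by ring, by linarith, fun h => (h rfl).elim⟩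
  · have hlt : (φ a + φ b) / 2 < φ ((a + b) / 2) := by
      have := h.2.2.1.2 ha hb hne (one_half_pos (α := ℝ)) one_half_pos (add_halves 1)
      simp only [smul_eq_mul] at this
      rw [show (1 / 2 : ℝ) * a + 1 / 2 * b = (a + b) / 2 by ring] at this
      linarith
    obtain ⟨z, hz, hzφ⟩ := h.exists_eq_of_le hab
      (by linarith [h.nonneg ha, h.nonneg hb]) hlt.le
    have hz' : z < (a + b) / 2 := by
      refine hz.2.lt_of_ne fun he => ?_
      rw [he] at hzφ
      linarith
    exact ⟨z, hz.1, hzφ, hz'.le, fun _ => hz'⟩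

lemma exists_totLat_lt_max [Fintype E] [DecidableEq V] {θ κ : E → V} {φ : E → ℝ → ℝ}
    (hφ : ∀ i, Standing (φ i)) {o d : V} {lam : ℝ} {y y' : E → ℝ}
    (hy : y ∈ eqFlow θ κ o d lam ∩ feas φ) (hy' : y' ∈ eqFlow θ κ o d lam ∩ feas φ)
    (hne : y ≠ y') :
    ∃ m ∈ eqFlow θ κ o d lam ∩ feas φ, totLat φ m < max (totLat φ y) (totLat φ y') := by
  obtain ⟨x, hx, rfl⟩ := exists_density_of_mem_feas hφ hy.2
  obtain ⟨x', hx', rfl⟩ := exists_density_of_mem_feas hφ hy'.2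
  choose z hz hzφ hzle hzlt using fun i => (hφ i).exists_midpoint (hx i) (hx' i)
  refine ⟨fun i => φ i (z i), ⟨⟨fun i => (hφ i).nonneg (hz i), fun w => ?_⟩,
    mem_feas_of_density hφ hz⟩, ?_⟩
  · have h1 := hy.1.2 w
    have h2 := hy'.1.2 w
    simp only [hzφ, mul_div_assoc', mul_add, ← Finset.sum_div, Finset.sum_add_distrib, h1, h2]
    ring
  · obtain ⟨j, hj⟩ : ∃ j, x j ≠ x' j := by
      by_contra! h
      exact hne (by simp [h])
    rw [totLat_density hφ hz, totLat_density hφ hx, totLat_density hφ hx']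
    have hlt : ∑ i, z i < ∑ i, (x i + x' i) / 2 :=
      Finset.sum_lt_sum (fun i _ => hzle i) ⟨j, Finset.mem_univ j, hzlt j hj⟩
    rw [← Finset.sum_div, Finset.sum_add_distrib] at hlt
    rw [lt_max_iff]
    by_contra! h
    linarith

lemma exists_totLat_le [Fintype E] [DecidableEq V] {θ κ : E → V} {φ : E → ℝ → ℝ}
    (hφ : ∀ i, Standing (φ i)) {o d : V} {lam : ℝ}
    (hne : (eqFlow θ κ o d lam ∩ feas φ).Nonempty) :
    ∃ y ∈ eqFlow θ κ o d lam ∩ feas φ, ∀ y' ∈ eqFlow θ κ o d lam ∩ feas φ,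
      totLat φ y ≤ totLat φ y' := by
  obtain ⟨y₀, hy₀, hf₀⟩ := hne
  obtain ⟨x₀, hx₀, rfl⟩ := exists_density_of_mem_feas hφ hf₀
  let b : E → ℝ := fun _ => ∑ j, x₀ j
  let Φ : (E → ℝ) → E → ℝ := fun x i => φ i (x i)
  have hcont : ContinuousOn Φ (Set.Icc 0 b) := continuousOn_pi.2 fun i =>
    (hφ i).continuousOn.comp (continuous_apply i).continuousOn fun x hx => hx.1 i
  have hclosed : IsClosed (eqFlow θ κ o d lam) := by
    simp only [eqFlow, Set.ofPred_and, Set.ofPred_forall]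
    exact (isClosed_iInter fun i => isClosed_le continuous_const (continuous_apply i)).inter
      (isClosed_iInter fun w => isClosed_eq (by fun_prop) continuous_const)
  have hK : IsCompact (Set.Icc 0 b ∩ Φ ⁻¹' eqFlow θ κ o d lam) :=
    isCompact_Icc.of_isClosed_subset
      (hcont.preimage_isClosed_of_isClosed isClosed_Icc hclosed) Set.inter_subset_left
  have hle_sum : ∀ x : E → ℝ, 0 ≤ x → ∀ i, x i ≤ ∑ j, x j := fun x hx i =>
    Finset.single_le_sum (fun j _ => hx j) (Finset.mem_univ i)
  have hmem₀ : x₀ ∈ Set.Icc 0 b ∩ Φ ⁻¹' eqFlow θ κ o d lam := ⟨⟨hx₀, hle_sum x₀ hx₀⟩, hy₀⟩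
  obtain ⟨x, ⟨⟨hx, -⟩, hxe⟩, hmin⟩ := hK.exists_isMinOn ⟨x₀, hmem₀⟩
    (f := fun x => ∑ i, x i) (by fun_prop)
  refine ⟨Φ x, ⟨hxe, mem_feas_of_density hφ hx⟩, fun y' hy' => ?_⟩
  obtain ⟨x', hx', rfl⟩ := exists_density_of_mem_feas hφ hy'.2
  rw [totLat_density hφ hx, totLat_density hφ hx']
  by_cases hb : ∑ i, x' i ≤ ∑ i, x₀ i
  · exact hmin ⟨⟨hx', fun i => (hle_sum x' hx' i).trans hb⟩, hy'.1⟩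
  · exact (hmin hmem₀).trans (not_le.1 hb).le

/-- For every throughput `0 ≤ λ < C^mincut`, the set of `o`-`d`
equilibrium flows of throughput `λ` intersects the set of feasible flows, and the total
latency admits a unique minimizer over this intersection: its value at the minimizer is
strictly smaller than at every other feasible equilibrium flow (infeasible equilibrium
flows having total latency `+∞` by convention). -/
theorem socialOptimum_exists_unique {V E : Type*} [Fintype V] [Fintype E]
    [DecidableEq V] (θ κ : E → V) (hloop : ∀ i, θ i ≠ κ i)
    (φ : E → ℝ → ℝ) (hφ : ∀ i, Standing (φ i)) (o d : V) (hod : d ≠ o)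
    (hreach : ∃ p : List E, IsSimplePath θ κ o d p)
    (lam : ℝ) (hlam0 : 0 ≤ lam) (hlam : ENNReal.ofReal lam < minCut θ κ o d φ) :
    (eqFlow θ κ o d lam ∩ feas φ).Nonempty ∧
      ∃ ystar ∈ eqFlow θ κ o d lam ∩ feas φ,
        ∀ y' ∈ eqFlow θ κ o d lam ∩ feas φ, y' ≠ ystar →
          totLat φ ystar < totLat φ y' := by
  have hne : (eqFlow θ κ o d lam ∩ feas φ).Nonempty := by
    obtain ⟨x, hx, hcut⟩ := exists_density_cut_le hφ hlam
    obtain ⟨y, hy, hyx⟩ := exists_eqFlow_le hloop (fun i => (hφ i).nonneg hx) hlam0 hcut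
    exact ⟨y, hy, fun i => ⟨hy.1 i,
      (ENNReal.ofReal_le_ofReal (hyx i)).trans_lt ((hφ i).ofReal_lt_cap hx)⟩⟩
  obtain ⟨ystar, hmem, hmin⟩ := exists_totLat_le hφ hne
  refine ⟨hne, ystar, hmem, fun y' hy' hne' => lt_of_not_ge fun hle => ?_⟩
  obtain ⟨m, hm, hlt⟩ := exists_totLat_lt_max hφ hy' hmem hne'
  rw [max_eq_right hle] at hlt
  exact hlt.not_ge (hmin m hm)

end Traffic
end
end

section
/- Consider a transportation network with flow-density functions satisfying the standing assumptions, an origin o and a destination d ≠ o reachable from o, and a throughput λ with 0 ≤ λ < C^mincut. Let y* := y*(λ) be the social optimum flow and define the constant tolls w*_i := y*_i · τ_i'(y*_i) for each link i. Then the unique generalized Wardrop equilibrium of throughput λ for the constant pricing policy ω(y) ≡ w* coincides with the social optimum flow y*(λ). -/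
open Set Filter Topology

noncomputable section

namespace Traffic

variable {V E : Type*}

section Latency

variable {φ : ℝ → ℝ}

theorem phiInv_apply (hφ : Standing φ) {x : ℝ} (hx : 0 ≤ x) : phiInv φ (φ x) = x :=
  hφ.2.1.injOn.leftInvOn_invFunOn hx

theorem phiInv_zero (hφ : Standing φ) : phiInv φ 0 = 0 := by
  simpa [hφ.2.2.2] using phiInv_apply hφ le_rfl

theorem mem_latDom_of_le {y y' : ℝ} (hy : y ∈ latDom φ) (h0 : 0 ≤ y') (hle : y' ≤ y) :
    y' ∈ latDom φ :=
  ⟨h0, (ENNReal.ofReal_le_ofReal hle).trans_lt hy.2⟩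

theorem exists_lt_of_mem_latDom {y : ℝ} (hy : y ∈ latDom φ) : ∃ x, 0 ≤ x ∧ y < φ x := by
  obtain ⟨x, hx⟩ := lt_iSup_iff.1 hy.2
  obtain ⟨hx0, hx⟩ := lt_iSup_iff.1 hx
  exact ⟨x, hx0, (ENNReal.ofReal_lt_ofReal_iff_of_nonneg hy.1).1 hx⟩

theorem exists_eq_of_mem_latDom (hφ : Standing φ) {y : ℝ} (hy : y ∈ latDom φ) :
    ∃ x, 0 ≤ x ∧ φ x = y := by
  obtain ⟨b, hb, hyb⟩ := exists_lt_of_mem_latDom hy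
  obtain ⟨x, hx, hxy⟩ := intermediate_value_Icc hb
    (hφ.1.continuousOn.mono Icc_subset_Ici_self) ⟨hφ.2.2.2.symm ▸ hy.1, hyb.le⟩
  exact ⟨x, hx.1, hxy⟩

theorem apply_mem_latDom (hφ : Standing φ) {x : ℝ} (hx : 0 ≤ x) : φ x ∈ latDom φ := by
  have h0 : 0 ≤ φ x := hφ.2.2.2 ▸ hφ.2.1.monotoneOn self_mem_Ici hx hx
  have hx1 : (0 : ℝ) ≤ x + 1 := by positivity
  refine ⟨h0, lt_of_lt_of_le ?_ (le_iSup₂ (f := fun x (_ : x ∈ Ici (0 : ℝ)) =>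
    ENNReal.ofReal (φ x)) (x + 1) hx1)⟩
  exact (ENNReal.ofReal_lt_ofReal_iff_of_nonneg h0).2 (hφ.2.1 hx hx1 (by linarith))

theorem eventually_mem_latDom (hφ : Standing φ) {y : ℝ} (hy : y ∈ latDom φ) :
    ∀ᶠ y' in 𝓝[Ici 0] y, y' ∈ latDom φ := by
  obtain ⟨b, hb, hyb⟩ := exists_lt_of_mem_latDom hy
  filter_upwards [self_mem_nhdsWithin, mem_nhdsWithin_of_mem_nhds (Iio_mem_nhds hyb)]
    with y' h0 hlt
  exact mem_latDom_of_le (apply_mem_latDom hφ hb) h0 hlt.le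

theorem strictMonoOn_phiInv (hφ : Standing φ) : StrictMonoOn (phiInv φ) (latDom φ) := by
  intro y hy y' hy' hlt
  obtain ⟨x, hx, rfl⟩ := exists_eq_of_mem_latDom hφ hy
  obtain ⟨x', hx', rfl⟩ := exists_eq_of_mem_latDom hφ hy'
  rw [phiInv_apply hφ hx, phiInv_apply hφ hx']
  exact (hφ.2.1.lt_iff_lt hx hx').1 hlt

theorem tendsto_phiInv (hφ : Standing φ) {y : ℝ} (hy : y ∈ latDom φ) :
    Tendsto (phiInv φ) (𝓝[Ici 0] y) (𝓝[Ici 0] (phiInv φ y)) := by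
  have hev := eventually_mem_latDom hφ hy
  obtain ⟨x, hx, rfl⟩ := exists_eq_of_mem_latDom hφ hy
  rw [phiInv_apply hφ hx]
  refine tendsto_nhdsWithin_iff.2 ⟨tendsto_order.2 ⟨fun a ha => ?_, fun b hb => ?_⟩, ?_⟩
  · rcases lt_or_ge a 0 with h | h
    · filter_upwards [hev] with y' hy'
      obtain ⟨x', hx', rfl⟩ := exists_eq_of_mem_latDom hφ hy'
      rw [phiInv_apply hφ hx']
      exact h.trans_le hx'
    · filter_upwards [hev, mem_nhdsWithin_of_mem_nhds (Ioi_mem_nhds (hφ.2.1 h hx ha))]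
        with y' hy' hlt
      simpa [phiInv_apply hφ h] using
        strictMonoOn_phiInv hφ (apply_mem_latDom hφ h) hy' hlt
  · have hb0 : 0 ≤ b := hx.trans hb.le
    filter_upwards [hev, mem_nhdsWithin_of_mem_nhds (Iio_mem_nhds (hφ.2.1 hx hb0 hb))]
      with y' hy' hlt
    simpa [phiInv_apply hφ hb0] using
      strictMonoOn_phiInv hφ hy' (apply_mem_latDom hφ hb0) hlt
  · filter_upwards [hev] with y' hy'
    obtain ⟨x', hx', rfl⟩ := exists_eq_of_mem_latDom hφ hy'
    rwa [phiInv_apply hφ hx']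

theorem hasDerivWithinAt_standing (hφ : Standing φ) {x : ℝ} (hx : 0 ≤ x) :
    HasDerivWithinAt φ (derivWithin φ (Ici 0) x) (Ici 0) x :=
  (hφ.1.differentiableOn (by norm_num) x hx).hasDerivWithinAt

theorem derivWithin_pos (hφ : Standing φ) {x : ℝ} (hx : 0 ≤ x) :
    0 < derivWithin φ (Ici 0) x := by
  have hx1 : (0 : ℝ) ≤ x + 1 := by positivity
  have hlt := hφ.2.2.1.slope_lt_of_hasDerivWithinAt hx hx1 (by linarith)
    (hasDerivWithinAt_standing hφ hx)
  have hmono := hφ.2.1 hx hx1 (by linarith)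
  simp only [slope_def_field, add_sub_cancel_left, div_one] at hlt
  linarith

theorem hasDerivWithinAt_phiInv (hφ : Standing φ) {y : ℝ} (hy : y ∈ latDom φ) :
    HasDerivWithinAt (phiInv φ) (derivWithin φ (Ici 0) (phiInv φ y))⁻¹ (Ici 0) y := by
  have hx : 0 ≤ phiInv φ y := by
    obtain ⟨x, hx, rfl⟩ := exists_eq_of_mem_latDom hφ hy
    rwa [phiInv_apply hφ hx]
  have hd := (hasDerivWithinAt_standing hφ hx).hasFDerivWithinAt
  have hne := (derivWithin_pos hφ hx).ne'
  have := HasFDerivWithinAt.of_comp_of_leftInverse (tendsto_phiInv hφ hy) hd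
    (hasFDerivWithinAt_id y (Ici 0))
    (f'symm := .toSpanSingleton ℝ (derivWithin φ (Ici 0) (phiInv φ y))⁻¹) ?_ ?_ hy.1
  · simpa using this.hasDerivWithinAt
  · filter_upwards [eventually_mem_latDom hφ hy] with y' hy'
    obtain ⟨x, hx, rfl⟩ := exists_eq_of_mem_latDom hφ hy'
    simp [phiInv_apply hφ hx]
  · intro z
    simp [hne]

theorem mul_latency (hφ : Standing φ) (y : ℝ) : y * latency φ y = phiInv φ y := by
  rcases eq_or_ne y 0 with rfl | h
  · simp [phiInv_zero hφ]
  · simp [latency, h, mul_div_cancel₀]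

theorem hasDerivWithinAt_phiInv_marginalCost (hφ : Standing φ) {y : ℝ} (hy : y ∈ latDom φ) :
    HasDerivWithinAt (phiInv φ) (latency φ y + y * deriv (latency φ) y) (Ici 0) y := by
  have hd := hasDerivWithinAt_phiInv hφ hy
  rcases hy.1.eq_or_lt with rfl | hpos
  · simpa [latency, phiInv_zero hφ] using hd
  · have hd' := hd.hasDerivAt (Ici_mem_nhds hpos)
    have hq := hd'.div (hasDerivAt_id y) hpos.ne'
    have hτ := hq.congr_of_eventuallyEq (f₁ := latency φ) (by
      filter_upwards [Ioi_mem_nhds hpos] with y' hy'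
      simp [latency, (mem_Ioi.1 hy').ne'])
    convert hd using 1
    rw [hτ.deriv]
    simp only [latency, hpos.ne', if_false, id]
    field_simp
    ring

theorem strictMonoOn_latency (hφ : Standing φ) : StrictMonoOn (latency φ) (latDom φ) := by
  intro y hy y' hy' hlt
  obtain ⟨x, hx, rfl⟩ := exists_eq_of_mem_latDom hφ hy
  obtain ⟨x', hx', rfl⟩ := exists_eq_of_mem_latDom hφ hy'
  have hxx : x < x' := (hφ.2.1.lt_iff_lt hx hx').1 hlt
  have hx'0 : 0 < x' := hx.trans_lt hxx
  have hφx' : 0 < φ x' := hy.1.trans_lt hlt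
  rcases hx.eq_or_lt with rfl | hpos
  · have hs := hφ.2.2.1.slope_lt_of_hasDerivWithinAt self_mem_Ici hx' hxx
      (hasDerivWithinAt_standing hφ le_rfl)
    have hd := derivWithin_pos hφ le_rfl
    simp only [slope_def_field, hφ.2.2.2, sub_zero] at hs
    simp only [latency, hφ.2.2.2, if_true, hφx'.ne', if_false, phiInv_apply hφ hx']
    rw [div_lt_iff₀ hx'0] at hs
    rw [div_lt_div_iff₀ hd hφx']
    linarith
  · have hφx : 0 < φ x := hφ.2.2.2 ▸ hφ.2.1 self_mem_Ici hx hpos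
    have hs := hφ.2.2.1.slope_anti_adjacent self_mem_Ici hx' hpos hxx
    simp only [hφ.2.2.2, sub_zero] at hs
    simp only [latency, hφx.ne', hφx'.ne', if_false, phiInv_apply hφ hx, phiInv_apply hφ hx']
    rw [div_lt_div_iff₀ (by linarith) hpos] at hs
    rw [div_lt_div_iff₀ hφx hφx']
    linarith

end Latency

section Walks

variable {θ κ : E → V}

/-- `IsWalk θ κ u v p` says that the links of `p` lead consecutively from `u` to `v`. -/
def IsWalk (θ κ : E → V) (u v : V) : List E → Prop
  | [] => u = v
  | i :: p => θ i = u ∧ IsWalk θ κ (κ i) v p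

theorem isWalk_iff {u v : V} {p : List E} (hp : p ≠ []) :
    IsWalk θ κ u v p ↔ (p.map θ).head? = some u ∧ (p.map κ).getLast? = some v ∧
      List.IsChain (fun a b => κ a = θ b) p := by
  induction p generalizing u with
  | nil => exact absurd rfl hp
  | cons i p ih =>
    cases p with
    | nil => simp [IsWalk]
    | cons j q =>
      rw [IsWalk, ih (List.cons_ne_nil _ _)]
      simp only [List.map_cons, List.head?_cons, Option.some.injEq, List.getLast?_cons_cons,
        List.isChain_cons_cons]
      constructor
      · rintro ⟨h1, h2, h3, h4⟩
        exact ⟨h1, h3, h2.symm, h4⟩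
      · rintro ⟨h1, h3, h2, h4⟩
        exact ⟨h1, h2.symm, h3, h4⟩

theorem Path.isWalk {o d : V} (γ : Path θ κ o d) : IsWalk θ κ o d γ.1 :=
  (isWalk_iff γ.2.1).2 ⟨γ.2.2.1, γ.2.2.2.1, γ.2.2.2.2.1⟩

theorem Path.nodup {o d : V} (γ : Path θ κ o d) : γ.1.Nodup :=
  (List.nodup_cons.1 γ.2.2.2.2.2).2.of_map _

theorem IsWalk.exists_suffix {u v x : V} {p : List E} (hw : IsWalk θ κ u v p)
    (hn : (u :: p.map κ).Nodup) (hx : x ∈ u :: p.map κ) :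
    ∃ q, q ⊆ p ∧ IsWalk θ κ x v q ∧ (x :: q.map κ).Nodup := by
  induction p generalizing u with
  | nil =>
    obtain rfl : x = u := by simpa using hx
    exact ⟨[], List.Subset.refl _, hw, hn⟩
  | cons i p ih =>
    rcases List.mem_cons.1 hx with rfl | hx
    · exact ⟨i :: p, List.Subset.refl _, hw, hn⟩
    · obtain ⟨q, hq, h⟩ := ih hw.2 (List.nodup_cons.1 hn).2 hx
      exact ⟨q, fun j hj => List.mem_cons_of_mem _ (hq hj), h⟩

theorem exists_simple_walk (S : E → Prop) {u v : V}
    (h : Relation.ReflTransGen (fun a b => ∃ i, S i ∧ θ i = a ∧ κ i = b) u v) :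
    ∃ p, (∀ i ∈ p, S i) ∧ IsWalk θ κ u v p ∧ (u :: p.map κ).Nodup := by
  induction h using Relation.ReflTransGen.head_induction_on with
  | refl => exact ⟨[], by simp, rfl, by simp⟩
  | head hstep _ ih =>
    rename_i a _ _
    obtain ⟨i, hi, rfl, rfl⟩ := hstep
    obtain ⟨p, hpS, hw, hn⟩ := ih
    by_cases hmem : θ i ∈ κ i :: p.map κ
    · obtain ⟨q, hq, h⟩ := hw.exists_suffix hn hmem
      exact ⟨q, fun j hj => hpS j (hq hj), h⟩
    · refine ⟨i :: p, ?_, ⟨rfl, hw⟩, List.nodup_cons.2 ⟨hmem, hn⟩⟩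
      simpa [hi] using hpS

theorem exists_path_of_reflTransGen (S : E → Prop) {o d : V} (hod : d ≠ o)
    (h : Relation.ReflTransGen (fun a b => ∃ i, S i ∧ θ i = a ∧ κ i = b) o d) :
    ∃ γ : Path θ κ o d, ∀ i ∈ γ.1, S i := by
  obtain ⟨p, hS, hw, hn⟩ := exists_simple_walk S h
  have hp : p ≠ [] := by
    rintro rfl
    exact hod hw.symm
  obtain ⟨h1, h2, h3⟩ := (isWalk_iff hp).1 hw
  exact ⟨⟨p, hp, h1, h2, h3, hn⟩, hS⟩

theorem Bmat_eq [DecidableEq V] (hloop : ∀ i, θ i ≠ κ i) (v : V) (i : E) :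
    Bmat θ κ v i = (if v = θ i then 1 else 0) - (if v = κ i then 1 else 0) := by
  unfold Bmat
  split_ifs with h1 h2
  · exact absurd (h1.symm.trans h2) (hloop i)
  all_goals norm_num

theorem IsWalk.sum_Bmat [DecidableEq V] (hloop : ∀ i, θ i ≠ κ i) (x : V) {u v : V}
    {p : List E} (hw : IsWalk θ κ u v p) :
    (p.map (Bmat θ κ x)).sum = (if x = u then 1 else 0) - (if x = v then 1 else 0) := by
  induction p generalizing u with
  | nil =>
    obtain rfl : u = v := hw
    simp
  | cons i p ih =>
    obtain ⟨rfl, hw⟩ := hw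
    rw [List.map_cons, List.sum_cons, ih hw, Bmat_eq hloop]
    ring

theorem Path.sum_Bmat_mul_Amat [Fintype E] [DecidableEq E] [DecidableEq V]
    (hloop : ∀ i, θ i ≠ κ i) {o d : V} (v : V) (γ : Path θ κ o d) :
    ∑ i, Bmat θ κ v i * Amat θ κ o d i γ =
      (if v = o then 1 else 0) - (if v = d then 1 else 0) := by
  rw [← γ.isWalk.sum_Bmat hloop v, ← List.sum_toFinset _ γ.nodup]
  simp [Amat, ← List.mem_toFinset]

/-- A nonnegative flow with positive net outflow at `o` and its only sink at `d` contains a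
simple path from `o` to `d` in its support. -/
theorem exists_path_of_divergence [Fintype V] [Fintype E] [DecidableEq V]
    (hloop : ∀ i, θ i ≠ κ i) {o d : V} (hod : d ≠ o) {r : E → ℝ} (hr : ∀ i, 0 ≤ r i)
    {μ : ℝ} (hμ : 0 < μ)
    (hdiv : ∀ v, ∑ i, Bmat θ κ v i * r i =
      μ * ((if v = o then (1 : ℝ) else 0) - (if v = d then 1 else 0))) :
    ∃ γ : Path θ κ o d, ∀ i ∈ γ.1, 0 < r i := by
  classical
  refine exists_path_of_reflTransGen (fun i => 0 < r i) hod ?_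
  by_contra hnot
  set R := Relation.ReflTransGen (fun a b => ∃ i, 0 < r i ∧ θ i = a ∧ κ i = b) o
  set U : Finset V := Finset.univ.filter R
  have ho : o ∈ U := by simpa [U] using Relation.ReflTransGen.refl
  have hd : d ∉ U := by simpa [U] using hnot
  have hout : ∑ v ∈ U, ∑ i, Bmat θ κ v i * r i = μ := by
    simp_rw [hdiv, ← Finset.mul_sum, Finset.sum_sub_distrib]
    simp [ho, hd]
  rw [Finset.sum_comm] at hout
  have hle : ∑ i, ∑ v ∈ U, Bmat θ κ v i * r i ≤ 0 := by
    refine Finset.sum_nonpos fun i _ => ?_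
    rw [← Finset.sum_mul]
    rcases (hr i).eq_or_lt with h | h
    · simp [← h]
    · refine mul_nonpos_of_nonpos_of_nonneg ?_ h.le
      simp_rw [Bmat_eq hloop, Finset.sum_sub_distrib]
      have himp : θ i ∈ U → κ i ∈ U := by
        simp only [U, Finset.mem_filter, Finset.mem_univ, true_and]
        exact fun hθ => hθ.tail ⟨i, h, rfl, rfl⟩
      by_cases h1 : θ i ∈ U
      · simp [h1, himp h1]
      · simp only [Finset.sum_ite_eq', h1, if_false, zero_sub, neg_nonpos]
        split_ifs <;> norm_num
  linarith

theorem Amat_nonneg [DecidableEq E] {o d : V} (i : E) (γ : Path θ κ o d) : 0 ≤ Amat θ κ o d i γ := by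
  unfold Amat
  split_ifs <;> norm_num

end Walks

section TotalLatency

variable [Fintype E]

theorem totLat_eq {φ : E → ℝ → ℝ} (hφ : ∀ i, Standing (φ i)) (y : E → ℝ) :
    totLat φ y = ∑ i, phiInv (φ i) (y i) :=
  Finset.sum_congr rfl fun i _ => mul_latency (hφ i) (y i)

theorem totLat_mono {φ : E → ℝ → ℝ} (hφ : ∀ i, Standing (φ i)) {y y' : E → ℝ}
    (hy : y ∈ feas φ) (hy' : y' ∈ feas φ) (hle : ∀ i, y i ≤ y' i) :
    totLat φ y ≤ totLat φ y' := by
  rw [totLat_eq hφ, totLat_eq hφ]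
  exact Finset.sum_le_sum fun i _ =>
    (strictMonoOn_phiInv (hφ i)).monotoneOn (hy i) (hy' i) (hle i)

end TotalLatency

section Flows

variable {θ κ : E → V} {o d : V} [Fintype E] [DecidableEq E] [Fintype (Path θ κ o d)]

theorem flowOf_nonneg {z : Path θ κ o d → ℝ} (hz : ∀ γ, 0 ≤ z γ) (i : E) :
    0 ≤ flowOf θ κ o d z i :=
  Finset.sum_nonneg fun γ _ => mul_nonneg (Amat_nonneg i γ) (hz γ)

theorem flowOf_add (z z' : Path θ κ o d → ℝ) (i : E) :
    flowOf θ κ o d (z + z') i = flowOf θ κ o d z i + flowOf θ κ o d z' i := by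
  simp [flowOf, mul_add, Finset.sum_add_distrib]

theorem flowOf_single [DecidableEq (Path θ κ o d)] (γ : Path θ κ o d) (c : ℝ) (i : E) :
    flowOf θ κ o d (Pi.single γ c) i = Amat θ κ o d i γ * c := by
  simp [flowOf, Pi.single_apply]

theorem sum_Bmat_mul_flowOf [DecidableEq V] (hloop : ∀ i, θ i ≠ κ i)
    (z : Path θ κ o d → ℝ) (v : V) :
    ∑ i, Bmat θ κ v i * flowOf θ κ o d z i =
      (∑ γ, z γ) * ((if v = o then (1 : ℝ) else 0) - (if v = d then 1 else 0)) := by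
  simp_rw [flowOf, Finset.mul_sum]
  rw [Finset.sum_comm, Finset.sum_mul]
  refine Finset.sum_congr rfl fun γ _ => ?_
  rw [← γ.sum_Bmat_mul_Amat hloop v, Finset.mul_sum]
  exact Finset.sum_congr rfl fun i _ => by ring

theorem flowOf_mem_eqFlow [DecidableEq V] (hloop : ∀ i, θ i ≠ κ i) {lam : ℝ}
    {z : Path θ κ o d → ℝ} (hz : z ∈ pathSimplex lam (Path θ κ o d)) :
    flowOf θ κ o d z ∈ eqFlow θ κ o d lam :=
  ⟨flowOf_nonneg hz.1, fun v => by rw [sum_Bmat_mul_flowOf hloop, hz.2]⟩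

/-- Every flow of throughput `lam` dominates the link flow of some path flow of the same
throughput. -/
theorem exists_flowOf_le [Fintype V] [DecidableEq V] (hloop : ∀ i, θ i ≠ κ i) (hod : d ≠ o)
    {lam : ℝ} (hlam : 0 ≤ lam) {y : E → ℝ} (hy : y ∈ eqFlow θ κ o d lam) :
    ∃ z ∈ pathSimplex lam (Path θ κ o d), ∀ i, flowOf θ κ o d z i ≤ y i := by
  classical
  let K : Set (Path θ κ o d → ℝ) :=
    {z | (∀ γ, 0 ≤ z γ) ∧ ∑ γ, z γ ≤ lam ∧ ∀ i, flowOf θ κ o d z i ≤ y i}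
  have hclosed : IsClosed K := by
    simp only [K, flowOf, ofPred_and, ofPred_forall]
    refine (isClosed_iInter fun γ => ?_).inter (IsClosed.inter ?_ (isClosed_iInter fun i => ?_))
    all_goals exact isClosed_le (by fun_prop) (by fun_prop)
  have hsub : K ⊆ Icc 0 (fun _ => lam) := fun z hz => ⟨hz.1, fun γ =>
    (Finset.single_le_sum (fun γ _ => hz.1 γ) (Finset.mem_univ γ)).trans hz.2.1⟩
  have hK : IsCompact K := isCompact_Icc.of_isClosed_subset hclosed hsub
  have hne : K.Nonempty := ⟨0, by simp [K, flowOf, hlam, hy.1]⟩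
  obtain ⟨z, hz, hmax⟩ := hK.exists_isMaxOn hne
    (f := fun z => ∑ γ, z γ) (by fun_prop)
  refine ⟨z, ⟨hz.1, hz.2.1.antisymm ?_⟩, hz.2.2⟩
  by_contra! hlt
  obtain ⟨γ, hγ⟩ := exists_path_of_divergence hloop hod
    (r := fun i => y i - flowOf θ κ o d z i) (fun i => sub_nonneg.2 (hz.2.2 i))
    (sub_pos.2 hlt) (fun v => by
      simp_rw [mul_sub, Finset.sum_sub_distrib]
      rw [hy.2, sum_Bmat_mul_flowOf hloop]
      ring)
  obtain ⟨i₀, hi₀, hmin⟩ := γ.1.toFinset.exists_min_image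
    (fun i => y i - flowOf θ κ o d z i) (List.toFinset_nonempty_iff _ |>.2 γ.2.1)
  set ε := min (lam - ∑ γ, z γ) (y i₀ - flowOf θ κ o d z i₀)
  have hε0 : 0 < ε := lt_min (sub_pos.2 hlt) (hγ i₀ (List.mem_toFinset.1 hi₀))
  have hsum : ∑ γ', (z + Pi.single γ ε : Path θ κ o d → ℝ) γ' = ∑ γ', z γ' + ε := by
    simp [Finset.sum_add_distrib]
  have hmem : z + Pi.single γ ε ∈ K := by
    refine ⟨fun γ' => add_nonneg (hz.1 γ') ?_, ?_, fun i => ?_⟩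
    · by_cases h : γ' = γ
      · subst h; simpa using hε0.le
      · simp [h]
    · rw [hsum]
      linarith [min_le_left (lam - ∑ γ, z γ) (y i₀ - flowOf θ κ o d z i₀)]
    · rw [flowOf_add, flowOf_single]
      by_cases hi : i ∈ γ.1
      · have h1 := hmin i (List.mem_toFinset.2 hi)
        have h2 := min_le_right (lam - ∑ γ, z γ) (y i₀ - flowOf θ κ o d z i₀)
        simp only [Amat, hi, if_true, one_mul]
        linarith
      · simpa [Amat, hi] using hz.2.2 i
  have := hmax hmem
  simp only [mem_ofPred_eq, hsum] at this
  linarith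

/-- Path costs aggregate to link costs. -/
theorem sum_mul_pathCost (φ ω : E → ℝ → ℝ) (y : E → ℝ) (z : Path θ κ o d → ℝ) :
    ∑ γ, z γ * pathCost θ κ o d φ ω y γ =
      ∑ i, flowOf θ κ o d z i * (latency (φ i) (y i) + ω i (y i)) := by
  simp_rw [pathCost, flowOf, Finset.mul_sum, Finset.sum_mul]
  rw [Finset.sum_comm]
  exact Finset.sum_congr rfl fun i _ => Finset.sum_congr rfl fun γ _ => by ring

/-- A generalized Wardrop equilibrium satisfies the Wardrop variational inequality. -/
theorem IsGWE.sum_le [DecidableEq V] {φ ω : E → ℝ → ℝ} {lam : ℝ} {y : E → ℝ}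
    (hy : IsGWE θ κ o d φ ω lam y) {z' : Path θ κ o d → ℝ}
    (hz' : z' ∈ pathSimplex lam (Path θ κ o d)) :
    ∑ i, y i * (latency (φ i) (y i) + ω i (y i)) ≤
      ∑ i, flowOf θ κ o d z' i * (latency (φ i) (y i) + ω i (y i)) := by
  obtain ⟨-, -, z, hz, hyz, hcost⟩ := hy
  have hsum : ∑ i, y i * (latency (φ i) (y i) + ω i (y i)) =
      ∑ γ, z γ * pathCost θ κ o d φ ω y γ := by
    rw [sum_mul_pathCost]
    exact Finset.sum_congr rfl fun i _ => by rw [← hyz i]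
  rw [hsum, ← sum_mul_pathCost]
  rcases isEmpty_or_nonempty (Path θ κ o d) with h | h
  · simp
  obtain ⟨γ₀, hγ₀⟩ := Finite.exists_min (pathCost θ κ o d φ ω y)
  calc ∑ γ, z γ * pathCost θ κ o d φ ω y γ
      ≤ ∑ γ, z γ * pathCost θ κ o d φ ω y γ₀ := by
        refine Finset.sum_le_sum fun γ _ => ?_
        rcases (hz.1 γ).eq_or_lt with h0 | h0
        · simp [← h0]
        · exact mul_le_mul_of_nonneg_left (hcost γ h0 γ₀) h0.le
    _ = ∑ γ, z' γ * pathCost θ κ o d φ ω y γ₀ := by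
        rw [← Finset.sum_mul, ← Finset.sum_mul, hz.2, hz'.2]
    _ ≤ ∑ γ, z' γ * pathCost θ κ o d φ ω y γ :=
        Finset.sum_le_sum fun γ _ => mul_le_mul_of_nonneg_left (hγ₀ γ) (hz'.1 γ)

theorem IsGWE.exists_pathSimplex [DecidableEq V] {φ ω : E → ℝ → ℝ} {lam : ℝ} {y : E → ℝ}
    (hy : IsGWE θ κ o d φ ω lam y) :
    ∃ z ∈ pathSimplex lam (Path θ κ o d), y = flowOf θ κ o d z :=
  let ⟨_, _, z, hz, hyz, _⟩ := hy
  ⟨z, hz, funext hyz⟩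

/-- Equilibria under constant tolls are unique. -/
theorem IsGWE.eq_of_const [DecidableEq V] {φ : E → ℝ → ℝ} (hφ : ∀ i, Standing (φ i))
    {w : E → ℝ} {lam : ℝ} {y y' : E → ℝ} (hy : IsGWE θ κ o d φ (fun i _ => w i) lam y)
    (hy' : IsGWE θ κ o d φ (fun i _ => w i) lam y') : y = y' := by
  obtain ⟨z, hz, hyz⟩ := hy.exists_pathSimplex
  obtain ⟨z', hz', hyz'⟩ := hy'.exists_pathSimplex
  have h1 := hy.sum_le hz'
  have h2 := hy'.sum_le hz
  rw [← hyz'] at h1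
  rw [← hyz] at h2
  have hterm : ∀ i, 0 ≤ (latency (φ i) (y i) - latency (φ i) (y' i)) * (y i - y' i) := by
    intro i
    have hmono := (strictMonoOn_latency (hφ i)).monotoneOn
    rcases le_total (y i) (y' i) with h | h
    · exact mul_nonneg_of_nonpos_of_nonpos
        (sub_nonpos.2 (hmono (hy.1 i) (hy'.1 i) h)) (sub_nonpos.2 h)
    · exact mul_nonneg (sub_nonneg.2 (hmono (hy'.1 i) (hy.1 i) h)) (sub_nonneg.2 h)
  have hsum : ∑ i, (latency (φ i) (y i) - latency (φ i) (y' i)) * (y i - y' i) =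
      (∑ i, y i * (latency (φ i) (y i) + w i) - ∑ i, y' i * (latency (φ i) (y i) + w i)) +
      (∑ i, y' i * (latency (φ i) (y' i) + w i) -
        ∑ i, y i * (latency (φ i) (y' i) + w i)) := by
    simp_rw [← Finset.sum_sub_distrib, ← Finset.sum_add_distrib]
    exact Finset.sum_congr rfl fun i _ => by ring
  have hzero := (Finset.sum_eq_zero_iff_of_nonneg fun i _ => hterm i).1
    (le_antisymm (by linarith) (Finset.sum_nonneg fun i _ => hterm i))
  funext i
  rcases mul_eq_zero.1 (hzero i (Finset.mem_univ i)) with h | h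
  · exact (strictMonoOn_latency (hφ i)).injOn (hy.1 i) (hy'.1 i) (sub_eq_zero.1 h)
  · exact sub_eq_zero.1 h

end Flows

section Optimum

variable {θ κ : E → V} {o d : V} [Fintype E] [DecidableEq E] [DecidableEq V]
  [Fintype (Path θ κ o d)]

/-- First-order optimality: at a minimizer of the total latency, used paths have minimal
marginal cost. -/
theorem pathCost_le_of_isMinOn_totLat (hloop : ∀ i, θ i ≠ κ i) {φ : E → ℝ → ℝ}
    (hφ : ∀ i, Standing (φ i)) {lam : ℝ} {z : Path θ κ o d → ℝ}
    (hz : z ∈ pathSimplex lam (Path θ κ o d)) (hfeas : flowOf θ κ o d z ∈ feas φ)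
    (hmin : IsMinOn (totLat φ) (eqFlow θ κ o d lam ∩ feas φ) (flowOf θ κ o d z))
    {γ : Path θ κ o d} (hγ : 0 < z γ) (γ' : Path θ κ o d) :
    pathCost θ κ o d φ
        (fun i _ => flowOf θ κ o d z i * deriv (latency (φ i)) (flowOf θ κ o d z i))
        (flowOf θ κ o d z) γ ≤
      pathCost θ κ o d φ
        (fun i _ => flowOf θ κ o d z i * deriv (latency (φ i)) (flowOf θ κ o d z i))
        (flowOf θ κ o d z) γ' := by
  classical
  set y := flowOf θ κ o d z
  let a : E → ℝ := fun i => Amat θ κ o d i γ' - Amat θ κ o d i γ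
  let c : E → ℝ := fun i => latency (φ i) (y i) + y i * deriv (latency (φ i)) (y i)
  let zt : ℝ → Path θ κ o d → ℝ := fun t => z + (Pi.single γ' t + Pi.single γ (-t))
  have hflow : ∀ t i, flowOf θ κ o d (zt t) i = y i + t * a i := by
    intro t i
    simp only [zt, flowOf_add, flowOf_single, a]
    ring
  have hzt : ∀ t ∈ Icc 0 (z γ), zt t ∈ pathSimplex lam (Path θ κ o d) := by
    intro t ht
    refine ⟨fun δ => ?_, ?_⟩
    · have h1 : 0 ≤ (Pi.single γ' t : Path θ κ o d → ℝ) δ :=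
        (Pi.single_nonneg.2 ht.1 : (0 : Path θ κ o d → ℝ) ≤ _) δ
      have h2 : 0 ≤ z δ + (Pi.single γ (-t) : Path θ κ o d → ℝ) δ := by
        by_cases h : δ = γ
        · subst h
          simpa using ht.2
        · simpa [h] using hz.1 δ
      simp only [zt, Pi.add_apply]
      linarith
    · simp [zt, Finset.sum_add_distrib, hz.2]
  have hmaps : ∀ i, MapsTo (fun t => y i + t * a i) (Icc 0 (z γ)) (Ici 0) := by
    intro i t ht
    simpa only [hflow, mem_Ici] using flowOf_nonneg (hzt t ht).1 i
  have hline : ∀ i, HasDerivWithinAt (fun t => y i + t * a i) (a i) (Icc 0 (z γ)) 0 := by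
    intro i
    simpa using (((hasDerivAt_id (0 : ℝ)).mul_const (a i)).const_add (y i)).hasDerivWithinAt
  have hderiv : HasDerivWithinAt (fun t => ∑ i, phiInv (φ i) (y i + t * a i))
      (∑ i, c i * a i) (Icc 0 (z γ)) 0 := by
    refine HasDerivWithinAt.fun_sum fun i _ => ?_
    refine HasDerivWithinAt.comp (h₂ := phiInv (φ i)) 0 ?_ (hline i) (hmaps i)
    simpa using hasDerivWithinAt_phiInv_marginalCost (hφ i) (hfeas i)
  have hlocal : IsLocalMinOn (fun t => ∑ i, phiInv (φ i) (y i + t * a i))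
      (Icc 0 (z γ)) 0 := by
    have hev : ∀ᶠ t in 𝓝[Icc 0 (z γ)] 0, ∀ i, y i + t * a i ∈ latDom (φ i) := by
      refine eventually_all.2 fun i => ?_
      have ht : Tendsto (fun t => y i + t * a i) (𝓝[Icc 0 (z γ)] 0) (𝓝[Ici 0] (y i)) := by
        simpa using (hline i).continuousWithinAt.tendsto_nhdsWithin (hmaps i)
      exact ht.eventually (eventually_mem_latDom (hφ i) (hfeas i))
    filter_upwards [hev, self_mem_nhdsWithin] with t ht htI
    have heq : flowOf θ κ o d (zt t) = fun i => y i + t * a i := funext (hflow t)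
    have := hmin (a := flowOf θ κ o d (zt t))
      ⟨flowOf_mem_eqFlow hloop (hzt t htI), heq ▸ ht⟩
    simpa [totLat_eq hφ, hflow] using this
  have hcone : z γ ∈ posTangentConeAt (Icc 0 (z γ)) (0 : ℝ) := by
    refine mem_posTangentConeAt_of_segment_subset ?_
    rw [zero_add, segment_eq_Icc hγ.le]
  have hnonneg := hlocal.hasFDerivWithinAt_nonneg hderiv.hasFDerivWithinAt hcone
  have hpos : 0 ≤ ∑ i, c i * a i := by
    refine nonneg_of_mul_nonneg_right ?_ hγ
    simpa using hnonneg
  have hsplit : ∑ i, c i * a i =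
      ∑ i, Amat θ κ o d i γ' * c i - ∑ i, Amat θ κ o d i γ * c i := by
    rw [← Finset.sum_sub_distrib]
    exact Finset.sum_congr rfl fun i _ => by ring
  exact sub_nonneg.1 (hsplit ▸ hpos)

end Optimum

/-- With the constant tolls `w*_i = y*_i τ_i'(y*_i)` computed at the
social optimum flow `y*` (the unique minimizer of the total latency over feasible
equilibrium flows of throughput `λ`), the unique generalized Wardrop equilibrium for the
constant pricing policy `ω(y) ≡ w*` coincides with `y*`. -/
theorem constant_marginal_tolls_give_social_optimum {V E : Type*} [Fintype V] [Fintype E]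
    [DecidableEq V] [DecidableEq E] (θ κ : E → V) (hloop : ∀ i, θ i ≠ κ i)
    (o d : V) (hod : d ≠ o) [Fintype (Path θ κ o d)]
    (hreach : Nonempty (Path θ κ o d))
    (hcover : ∀ i : E, ∃ γ : Path θ κ o d, i ∈ γ.1)
    (φ : E → ℝ → ℝ) (hφ : ∀ i, Standing (φ i))
    (lam : ℝ) (hlam0 : 0 ≤ lam) (hlam : ENNReal.ofReal lam < minCut θ κ o d φ)
    (ystar : E → ℝ) (hmem : ystar ∈ eqFlow θ κ o d lam ∩ feas φ)
    (hmin : ∀ y' ∈ eqFlow θ κ o d lam ∩ feas φ, y' ≠ ystar →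
      totLat φ ystar < totLat φ y') :
    IsGWE θ κ o d φ (fun i _ => ystar i * deriv (latency (φ i)) (ystar i)) lam ystar ∧
      ∀ y, IsGWE θ κ o d φ (fun i _ => ystar i * deriv (latency (φ i)) (ystar i)) lam y →
        y = ystar := by
  have hopt : IsMinOn (totLat φ) (eqFlow θ κ o d lam ∩ feas φ) ystar := fun y' hy' => by
    rcases eq_or_ne y' ystar with rfl | h
    · exact le_refl (totLat φ y')
    · exact (hmin y' hy' h).le
  obtain ⟨z, hz, hle⟩ := exists_flowOf_le hloop hod hlam0 hmem.1
  have hfeas : flowOf θ κ o d z ∈ feas φ := fun i =>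
    mem_latDom_of_le (hmem.2 i) (flowOf_nonneg hz.1 i) (hle i)
  have heq : flowOf θ κ o d z = ystar := by
    by_contra hne
    exact (hmin _ ⟨flowOf_mem_eqFlow hloop hz, hfeas⟩ hne).not_ge
      (totLat_mono hφ hfeas hmem.2 hle)
  subst heq
  have hgwe : IsGWE θ κ o d φ
      (fun i _ => flowOf θ κ o d z i * deriv (latency (φ i)) (flowOf θ κ o d z i)) lam
      (flowOf θ κ o d z) :=
    ⟨hfeas, hmem.1, z, hz, fun _ => rfl, fun _ hγ γ' =>
      pathCost_le_of_isMinOn_totLat hloop hφ hz hfeas hopt hγ γ'⟩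
  exact ⟨hgwe, fun y hy => hy.eq_of_const hφ hgwe⟩

end Traffic
end
end

section
/- Consider the closed-loop dynamics of a transportation network with flow-density functions satisfying the standing assumptions, throughput 0 < λ < C^mincut, a Lipschitz decentralized monotone pricing policy ω, update rate η > 0, and perturbed best response F^h given by an admissible perturbation h with domain Z_h ⊆ Z closed. Then there exist t₀ ≥ 0 and, for every link i ∈ E, a constant C̄_i with 0 < C̄_i < C_i not depending on η, such that for every solution with initial condition (z(0), x(0)) ∈ Z° × ℝ₊^E, the flow associated to the path preference satisfies y^{z(t)}_i ≤ C̄_i for all t ≥ t₀ and all i ∈ E. -/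
open Set Filter Topology

noncomputable section

namespace Traffic

variable {V E : Type*}

/-- Path flows depend continuously on the path preference vector. -/
theorem continuous_flowOf [Fintype E] [DecidableEq E] (θ κ : E → V) (o d : V)
    [Fintype (Path θ κ o d)] (i : E) : Continuous fun z => flowOf θ κ o d z i := by
  unfold flowOf
  fun_prop

/-- The flow on a link is at most the throughput. -/
theorem flowOf_le_of_mem_pathSimplex [Fintype E] [DecidableEq E] (θ κ : E → V) (o d : V)
    [Fintype (Path θ κ o d)] {lam : ℝ} {z : Path θ κ o d → ℝ}
    (hz : z ∈ pathSimplex lam (Path θ κ o d)) (i : E) : flowOf θ κ o d z i ≤ lam := by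
  rw [← hz.2, flowOf]
  refine Finset.sum_le_sum fun γ _ => ?_
  have := hz.1 γ
  unfold Amat
  split_ifs <;> simp [this]

/-- A closed subset of the simplex is compact. -/
theorem isCompact_of_subset_pathSimplex {Γ : Type*} [Fintype Γ] {lam : ℝ} {s : Set (Γ → ℝ)}
    (hs : IsClosed s) (hsub : s ⊆ pathSimplex lam Γ) : IsCompact s := by
  refine (isCompact_Icc (a := (0 : Γ → ℝ)) (b := fun _ => lam)).of_isClosed_subset hs ?_
  intro z hz
  obtain ⟨h0, h1⟩ := hsub hz
  refine ⟨h0, fun γ => ?_⟩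
  rw [← h1]
  exact Finset.single_le_sum (fun γ _ => h0 γ) (Finset.mem_univ γ)

/-- Grönwall-type bound for a relaxation towards a target that stays below `M`. -/
theorem le_add_exp_of_relaxation {f u : ℝ → ℝ} {η M : ℝ} (hη : 0 < η)
    (hf : ∀ t ≥ (0:ℝ), HasDerivWithinAt f (η * (u t - f t)) (Set.Ici 0) t)
    (hu : ∀ t ≥ (0:ℝ), u t ≤ M) {t : ℝ} (ht : 0 ≤ t) :
    f t ≤ M + Real.exp (-(η * t)) * (f 0 - M) := by
  have hg : ∀ s ≥ (0:ℝ), HasDerivWithinAt (fun s => Real.exp (η * s) * (f s - M))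
      (Real.exp (η * s) * (η * (u s - M))) (Set.Ici 0) s := by
    intro s hs
    have he : HasDerivAt (fun s => Real.exp (η * s)) (Real.exp (η * s) * η) s := by
      simpa using ((hasDerivAt_id s).const_mul η).exp
    exact (he.hasDerivWithinAt.mul ((hf s hs).sub_const M)).congr_deriv (by ring)
  have hanti : AntitoneOn (fun s => Real.exp (η * s) * (f s - M)) (Set.Ici 0) := by
    refine antitoneOn_of_hasDerivWithinAt_nonpos (convex_Ici 0)
      (f' := fun s => Real.exp (η * s) * (η * (u s - M)))
      (fun s hs => (hg s hs).continuousWithinAt)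
      (fun s hs => (hg s (interior_subset hs)).mono interior_subset) fun s hs => ?_
    have := hu s (interior_subset hs)
    exact mul_nonpos_of_nonneg_of_nonpos (Real.exp_pos _).le
      (mul_nonpos_of_nonneg_of_nonpos hη.le (by linarith))
  have key := hanti Set.self_mem_Ici (Set.mem_Ici.2 ht) ht
  simp only [mul_zero, Real.exp_zero, one_mul] at key
  have h1 : Real.exp (-(η * t)) * Real.exp (η * t) = 1 := by
    rw [← Real.exp_add]; simp
  have h2 := mul_le_mul_of_nonneg_left key (Real.exp_pos (-(η * t))).le
  rw [← mul_assoc, h1] at h2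
  linarith

/-- Along the closed-loop dynamics, the flows `y^{z(t)}` associated to
the path preferences eventually stay bounded away from the capacities, by constants
`C̄_i < C_i` not depending on the update rate `η`. -/
theorem flowOf_eventually_bounded {V E : Type*} [Fintype V] [Fintype E]
    [DecidableEq V] [DecidableEq E] (θ κ : E → V) (hloop : ∀ i, θ i ≠ κ i)
    (o d : V) (hod : d ≠ o) [Fintype (Path θ κ o d)]
    (hreach : Nonempty (Path θ κ o d))
    (hcover : ∀ i : E, ∃ γ : Path θ κ o d, i ∈ γ.1)
    (φ : E → ℝ → ℝ) (hφ : ∀ i, Standing (φ i))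
    (ω : E → ℝ → ℝ) (hmon : MonotonePolicy φ ω) (hlip : LipschitzPolicy φ ω)
    (lam : ℝ) (hlam0 : 0 < lam) (hlam : ENNReal.ofReal lam < minCut θ κ o d φ)
    (Zh : Set (Path θ κ o d → ℝ)) (h : (Path θ κ o d → ℝ) → ℝ)
    (hadm : Admissible (Zfeas θ κ o d φ lam) Zh h)
    (Fh : (E → ℝ) → (E → ℝ) → Path θ κ o d → ℝ)
    (hFh : IsPerturbedBR θ κ o d Zh h Fh) :
    ∃ Cb : E → ℝ, (∀ i, 0 < Cb i ∧ ENNReal.ofReal (Cb i) < cap (φ i)) ∧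
      ∀ η > (0:ℝ), ∃ t₀ ≥ (0:ℝ), ∀ x z, IsSolution θ κ o d φ ω lam η Fh x z →
        z 0 ∈ Zint θ κ o d φ lam →
        ∀ t ≥ t₀, ∀ i, flowOf θ κ o d (z t) i ≤ Cb i := by
  obtain ⟨hsub, hclosed, -⟩ := hadm
  have hcomp : IsCompact Zh :=
    isCompact_of_subset_pathSimplex hclosed fun z hz => (hsub hz).1
  have hbound : ∀ i, ∃ M : ℝ, 0 ≤ M ∧ ENNReal.ofReal M < cap (φ i) ∧
      ∀ z ∈ Zh, flowOf θ κ o d z i ≤ M := by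
    intro i
    obtain ⟨z, hz, hmax⟩ := hcomp.exists_isMaxOn ⟨_, (hFh 0 0).1⟩
      (continuous_flowOf θ κ o d i).continuousOn
    exact ⟨_, ((hsub hz).2 i).1, ((hsub hz).2 i).2, fun z' hz' => hmax hz'⟩
  choose M hM0 hMcap hM using hbound
  have hbetween : ∀ i, ∃ c : ℝ, M i < c ∧ ENNReal.ofReal c < cap (φ i) := by
    intro i
    obtain ⟨c, hc1, hc2⟩ := exists_between (hMcap i)
    have hc : c ≠ ⊤ := hc2.ne_top
    exact ⟨c.toReal, (ENNReal.ofReal_lt_iff_lt_toReal (hM0 i) hc).1 hc1,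
      by rwa [ENNReal.ofReal_toReal hc]⟩
  choose Cb hCbM hCbcap using hbetween
  refine ⟨Cb, fun i => ⟨(hM0 i).trans_lt (hCbM i), hCbcap i⟩, fun η hη => ?_⟩
  have hlim : Tendsto (fun t : ℝ => Real.exp (-(η * t)) * lam) atTop (𝓝 0) := by
    have : Tendsto (fun t : ℝ => -(η * t)) atTop atBot :=
      tendsto_neg_atTop_atBot.comp (tendsto_id.const_mul_atTop hη)
    simpa using (Real.tendsto_exp_atBot.comp this).mul_const lam
  have hev : ∀ᶠ t : ℝ in atTop, ∀ i, Real.exp (-(η * t)) * lam < Cb i - M i :=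
    eventually_all.2 fun i => hlim.eventually_lt_const (sub_pos.2 (hCbM i))
  obtain ⟨T, hT⟩ := eventually_atTop.1 hev
  refine ⟨max T 0, le_max_right _ _, fun x z hsol _ t ht i => ?_⟩
  obtain ⟨-, -, hzS, -, -, hz⟩ := hsol
  have hderiv : ∀ s ≥ (0:ℝ), HasDerivWithinAt (fun s => flowOf θ κ o d (z s) i)
      (η * (flowOf θ κ o d (Fh (fun i => latency (φ i) (φ i (x s i)))
        (fun i => ω i (φ i (x s i)))) i - flowOf θ κ o d (z s) i)) (Set.Ici 0) s := by
    intro s hs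
    unfold flowOf
    refine (HasDerivWithinAt.fun_sum fun γ _ =>
      (hz s hs γ).const_mul (Amat θ κ o d i γ)).congr_deriv ?_
    rw [← Finset.sum_sub_distrib, Finset.mul_sum]
    exact Finset.sum_congr rfl fun γ _ => by ring
  have hle := le_add_exp_of_relaxation hη hderiv (fun s _ => hM i _ (hFh _ _).1)
    ((le_max_right _ _).trans ht)
  have h0 := flowOf_le_of_mem_pathSimplex θ κ o d (hzS 0 le_rfl) i
  have hmul := mul_le_mul_of_nonneg_left
    (show flowOf θ κ o d (z 0) i - M i ≤ lam by linarith [hM0 i]) (Real.exp_pos (-(η * t))).le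
  linarith [hT t ((le_max_left _ _).trans ht) i]

end Traffic
end
end
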